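/- Let I be any type and consider conditions over I: functions p : I → Option Bool with finite support, where two conditions are compatible if they agree at every index at which both are defined (equivalently, they have a common extension). Then every antichain, i.e. every set of pairwise incompatible conditions, is countable. In particular the finite-support Cohen forcing Fn(ω₁ × ℕ × ℕ, 2, <ω) satisfies the countable chain condition. -/

import Mathlib

/-- Two partial conditions are compatible if they agree wherever both are defined. -/
def CondCompatible {I : Type*} (p q : I → Option Bool) : Prop :=
  ∀ x : I, p x ≠ none → q x ≠ none → p x = q x

/-- An antichain of finite conditions that all agree on `S` and have fewer than `n` values
outside `S` is countable. -/
theorem countable_antichain_of_ncard_lt {I : Type*} (n : ℕ) (S : Set I)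
    (A : Set (I → Option Bool))
    (hfin : ∀ p ∈ A, {x : I | p x ≠ none}.Finite)
    (hanti : ∀ p ∈ A, ∀ q ∈ A, p ≠ q → ¬ CondCompatible p q)
    (hS : ∀ p ∈ A, ∀ q ∈ A, ∀ x ∈ S, p x = q x)
    (hn : ∀ p ∈ A, ({x : I | p x ≠ none} \ S).ncard < n) :
    A.Countable := by
  induction n generalizing S A with
  | zero =>
    rw [Set.eq_empty_of_forall_notMem fun p hp => Nat.not_lt_zero _ (hn p hp)]
    exact Set.countable_empty
  | succ n ih =>
    rcases A.eq_empty_or_nonempty with rfl | ⟨p, hp⟩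
    · exact Set.countable_empty
    have hcover : A ⊆ {p} ∪ ⋃ x ∈ {x : I | p x ≠ none} \ S, ⋃ v : Bool,
        {q ∈ A | q x = some v} := by
      intro q hq
      by_cases hpq : p = q
      · exact Or.inl hpq.symm
      right
      have hinc := hanti p hp q hq hpq
      simp only [CondCompatible, not_forall] at hinc
      obtain ⟨x, hpx, hqx, hne⟩ := hinc
      obtain ⟨v, hv⟩ := Option.ne_none_iff_exists'.mp hqx
      simp only [Set.mem_iUnion]
      exact ⟨x, ⟨hpx, fun hx => hne (hS p hp q hq x hx)⟩, v, hq, hv⟩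
    refine ((Set.countable_singleton p).union
      (((hfin p hp).sdiff).countable.biUnion fun x hx =>
        Set.countable_iUnion fun v => ?_)).mono hcover
    refine ih (insert x S) _ (fun q hq => hfin q hq.1)
      (fun q hq r hr => hanti q hq.1 r hr.1) ?_ ?_
    · rintro q hq r hr y (rfl | hy)
      · exact hq.2.trans hr.2.symm
      · exact hS q hq.1 r hr.1 y hy
    · intro q hq
      refine (Set.ncard_lt_ncard ?_ (hfin q hq.1).sdiff).trans_le (Nat.le_of_lt_succ (hn q hq.1))
      refine (Set.ssubset_iff_of_subset
        (Set.sdiff_subset_sdiff_right (Set.subset_insert x S))).mpr ⟨x, ⟨?_, hx.2⟩, ?_⟩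
      · simp [hq.2]
      · exact fun h => h.2 (Set.mem_insert x S)

theorem cohen_forcing_ccc {I : Type*}
    (𝒜 : Set (I → Option Bool))
    (hfin : ∀ p ∈ 𝒜, {x : I | p x ≠ none}.Finite)
    (hanti : ∀ p ∈ 𝒜, ∀ q ∈ 𝒜, p ≠ q → ¬ CondCompatible p q) :
    𝒜.Countable := by
  have hcover : 𝒜 ⊆ ⋃ n : ℕ, {p ∈ 𝒜 | {x : I | p x ≠ none}.ncard < n} := fun p hp =>
    Set.mem_iUnion.mpr ⟨_, hp, Nat.lt_succ_self _⟩
  refine (Set.countable_iUnion fun n => ?_).mono hcover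
  exact countable_antichain_of_ncard_lt n ∅ _ (fun p hp => hfin p hp.1)
    (fun p hp q hq => hanti p hp.1 q hq.1) (fun _ _ _ _ _ hx => hx.elim)
    (fun p hp => by simpa using hp.2)
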